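/- Let j, Q ∈ ℕ with Q even and sufficiently large depending on j (in particular Q/2 + 8j < Q), and let P ∈ ℕ with P > Q·log(2j²). Then for any E ⊆ {0,1,...,Q^P - 1} with |E| > Q^P/j, there exists y ∈ E - E, y > 0, such that when y is written in base Q as y = Σ_{i=0}^{P-1} y_i Q^i with digits y_i ∈ {0,...,Q-1}, there is exactly one index s with Q/2 ≤ y_s < Q/2 + 8j, and all other digits satisfy 1 ≤ y_i < 8j. -/

import Mathlib

open Finset

/-- If, for every `m`, the block `[m * Q, (m + 1) * Q)` contains at least two points outside `F`,
then the cardinality of `F` is at most the sum over `i < Q - 2` of the number of blocks in which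
`F` meets the window of offsets `i, i + 1, i + 2`. -/
lemma card_le_sum_card_window_blocks {Q N : ℕ} (F : Finset ℕ) (hF : F ⊆ range (N * Q))
    (hmiss : ∀ m, ∃ p q, p < q ∧ q < Q ∧ m * Q + p ∉ F ∧ m * Q + q ∉ F) :
    F.card ≤ ∑ i ∈ range (Q - 2),
      ((range N).filter fun m => ∃ c ∈ Icc i (i + 2), m * Q + c ∈ F).card := by
  choose p q hpq hqQ hp hq using hmiss
  rw [← card_sigma]
  have hdm : ∀ n : ℕ, n / Q * Q + n % Q = n := fun n => Nat.div_add_mod' n Q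
  have hne : ∀ n ∈ F, n % Q ≠ p (n / Q) ∧ n % Q ≠ q (n / Q) := by
    refine fun n hn => ⟨fun h => hp (n / Q) ?_, fun h => hq (n / Q) ?_⟩
    · rwa [← h, hdm]
    · rwa [← h, hdm]
  have hQ : 0 < Q := lt_of_le_of_lt (Nat.zero_le _) (hqQ 0)
  refine card_le_card_of_injOn
    (fun n => ⟨if n % Q < p (n / Q) then n % Q
      else if n % Q < q (n / Q) then n % Q - 1 else n % Q - 2, n / Q⟩) ?_ ?_
  · intro n hn
    have hn : n ∈ F := hn
    have h1 := hne n hn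
    have h2 := hpq (n / Q)
    have h3 := hqQ (n / Q)
    have h4 := Nat.mod_lt n hQ
    have h5 : n / Q < N := Nat.div_lt_of_lt_mul (by
      rw [mul_comm]; exact mem_range.1 (hF hn))
    simp only [coe_sigma, Set.mem_sigma_iff, mem_coe, mem_range, mem_filter, mem_Icc]
    refine ⟨by split_ifs <;> omega, h5, n % Q, ⟨?_, ?_⟩, by rwa [hdm]⟩
    · split_ifs <;> omega
    · split_ifs <;> omega
  · intro x hx y hy hxy
    have hx := hne x hx
    have hy := hne y hy
    simp only [Sigma.mk.injEq, heq_eq_eq] at hxy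
    obtain ⟨h1, h2⟩ := hxy
    have h3 := hpq (x / Q)
    rw [← h2] at h1 hy
    have h4 : x % Q = y % Q := by split_ifs at h1 <;> omega
    rw [← hdm x, ← hdm y, h2, h4]

/-- A set of more than `(Q - 2) ^ P` numbers below `Q ^ P` contains two elements whose base-`Q`
digits differ by exactly `h` at one place and by at most `2` at all other places. -/
lemma exists_digit_jump {Q h : ℕ} (hh : 2 ≤ h) (hhQ : h + 1 < Q) :
    ∀ (P : ℕ) (F : Finset ℕ), F ⊆ range (Q ^ P) → (Q - 2) ^ P < F.card →
      ∃ x ∈ F, ∃ y ∈ F, ∃ (s : ℕ) (e : ℕ → ℤ), s < P ∧ e s = h ∧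
        (∀ i, i ≠ s → -2 ≤ e i ∧ e i ≤ 2) ∧ (y : ℤ) = x + ∑ i ∈ range P, e i * (Q : ℤ) ^ i := by
  intro P
  induction P with
  | zero =>
    intro F hF hc
    have := card_le_card hF
    simp at this hc
    omega
  | succ P ih =>
    intro F hF hc
    by_cases hjump : ∃ m t, t < 2 ∧ m * Q + t ∈ F ∧ m * Q + (t + h) ∈ F
    · obtain ⟨m, t, -, h1, h2⟩ := hjump
      refine ⟨_, h1, _, h2, 0, fun i => if i = 0 then h else 0, by omega, by simp,
        fun i hi => by simp [hi], ?_⟩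
      simp
      ring
    · push Not at hjump
      have hcard := card_le_sum_card_window_blocks (Q := Q) (N := Q ^ P) F
        (by rwa [← pow_succ]) (fun m => by
          have h0 := hjump m 0 (by omega)
          have h1 := hjump m 1 (by omega)
          simp only [zero_add] at h0
          by_cases a0 : m * Q + 0 ∈ F <;> by_cases a1 : m * Q + 1 ∈ F
          · exact ⟨h, 1 + h, by omega, by omega, h0 a0, h1 a1⟩
          · exact ⟨1, h, by omega, by omega, a1, h0 a0⟩
          · exact ⟨0, 1 + h, by omega, by omega, a0, h1 a1⟩
          · exact ⟨0, 1, by omega, by omega, a0, a1⟩)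
      obtain ⟨i, -, hi⟩ : ∃ i ∈ range (Q - 2), (Q - 2) ^ P < ((range (Q ^ P)).filter fun m =>
          ∃ c ∈ Icc i (i + 2), m * Q + c ∈ F).card := by
        by_contra! hle
        have := hcard.trans (sum_le_card_nsmul _ _ _ hle)
        rw [card_range, smul_eq_mul, ← pow_succ'] at this
        omega
      obtain ⟨x, hx, y, hy, s, e, hs, hes, he, hxy⟩ := ih _ (filter_subset _ _) hi
      obtain ⟨-, c, hcI, hcF⟩ := mem_filter.1 hx
      obtain ⟨-, d, hdI, hdF⟩ := mem_filter.1 hy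
      rw [mem_Icc] at hcI hdI
      refine ⟨_, hcF, _, hdF, s + 1, fun i => if i = 0 then (d : ℤ) - c else e (i - 1),
        by omega, by simpa using hes, fun i hi => ?_, ?_⟩
      · rcases i with _ | i
        · simp only [if_true]; omega
        · simpa using he i (by omega)
      · have : ∑ i ∈ range P, e i * (Q : ℤ) ^ (i + 1)
            = (∑ i ∈ range P, e i * (Q : ℤ) ^ i) * Q := by
          rw [sum_mul]
          exact sum_congr rfl fun i _ => by ring
        simp [sum_range_succ', this]
        rw [hxy]
        ring

lemma sum_mul_pow_div_mod {Q : ℕ} : ∀ (P : ℕ) (d : ℕ → ℕ), (∀ i, d i < Q) →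
    ∀ i < P, (∑ k ∈ range P, d k * Q ^ k) / Q ^ i % Q = d i := by
  intro P
  induction P with
  | zero => intro d hd i hi; omega
  | succ P ih =>
    intro d hd i hi
    have hQ : 0 < Q := lt_of_le_of_lt (Nat.zero_le _) (hd 0)
    have hsum : ∑ k ∈ range (P + 1), d k * Q ^ k
        = d 0 + Q * ∑ k ∈ range P, d (k + 1) * Q ^ k := by
      rw [sum_range_succ', mul_sum, add_comm]
      congr 1
      · simp
      · exact sum_congr rfl fun k _ => by ring
    rw [hsum]
    rcases i with _ | i
    · simp [Nat.mod_eq_of_lt (hd 0)]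
    · rw [pow_succ', ← Nat.div_div_eq_div_mul, Nat.add_mul_div_left _ _ hQ,
        Nat.div_eq_of_lt (hd 0), zero_add]
      exact ih (fun k => d (k + 1)) (fun k => hd _) i (by omega)

/-- If the sets `A l` of cardinality `c` have pairwise intersections of size at most `B`, then
their union has almost full size. -/
lemma mul_card_le_card_biUnion_add {α : Type*} [DecidableEq α] (A : ℕ → Finset α) (c B : ℕ)
    (hA : ∀ l, (A l).card = c) (n : ℕ) (hB : ∀ l l', l < l' → l' < n → (A l ∩ A l').card ≤ B) :
    n * c ≤ ((range n).biUnion A).card + n * n * B := by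
  induction n with
  | zero => simp
  | succ n ih =>
    have h1 := ih fun l l' h h' => hB l l' h (by omega)
    have h2 : (A n ∩ (range n).biUnion A).card ≤ n * B := by
      rw [inter_biUnion]
      refine card_biUnion_le.trans ((sum_le_card_nsmul _ _ B fun l hl => ?_).trans (by simp))
      rw [inter_comm]
      exact hB l n (mem_range.1 hl) (by omega)
    have h3 := card_union_add_card_inter (A n) ((range n).biUnion A)
    rw [hA] at h3
    rw [range_add_one, biUnion_insert]
    nlinarith

lemma four_mul_pow_four_mul_sub_two_pow_le {j Q P : ℕ} (hj : 0 < j) (hQ : 2 ≤ Q)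
    (hP : (P : ℝ) > Q * Real.log (2 * j ^ 2)) :
    4 * (j : ℝ) ^ 4 * ((Q - 2 : ℕ) : ℝ) ^ P ≤ (Q : ℝ) ^ P := by
  have hQ0 : (0 : ℝ) < Q := by positivity
  have hj0 : (0 : ℝ) < j := by positivity
  have h1 : ((Q - 2 : ℕ) : ℝ) ≤ Q * Real.exp (-(2 / Q)) := by
    have := Real.add_one_le_exp (-(2 / Q : ℝ))
    calc ((Q - 2 : ℕ) : ℝ) = Q * (-(2 / Q) + 1) := by
          rw [Nat.cast_sub hQ]; field_simp; push_cast; ring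
      _ ≤ _ := by gcongr
  have h2 : 2 * (j : ℝ) ^ 2 ≤ Real.exp (P / Q) := by
    rw [← Real.log_le_iff_le_exp (by positivity), le_div_iff₀ hQ0]
    linarith
  have h3 : 4 * (j : ℝ) ^ 4 ≤ Real.exp (P / Q) ^ 2 := by
    calc 4 * (j : ℝ) ^ 4 = (2 * (j : ℝ) ^ 2) ^ 2 := by ring
      _ ≤ _ := by gcongr
  have h4 : Real.exp (P / Q) ^ 2 * Real.exp (-(2 / Q)) ^ P = 1 := by
    rw [← Real.exp_nat_mul, ← Real.exp_nat_mul, ← Real.exp_add, Real.exp_eq_one_iff]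
    push_cast
    ring
  calc 4 * (j : ℝ) ^ 4 * ((Q - 2 : ℕ) : ℝ) ^ P
      ≤ Real.exp (P / Q) ^ 2 * (Q * Real.exp (-(2 / Q))) ^ P := by gcongr
    _ = (Q : ℝ) ^ P := by rw [mul_pow, mul_left_comm, h4, mul_one]

/-- A dense subset of `[0, Q ^ P)` has many pairs at distance `k * (1 + Q + ⋯ + Q ^ (P - 1))`, for
some `k` that is neither too small nor too large. -/
lemma exists_many_repunit_shifts {j Q P : ℕ} (hj : 2 ≤ j) (hQ : 16 * j < Q) {E : Finset ℕ}
    (hE : E ⊆ range (Q ^ P)) (hcard : Q ^ P < j * E.card) {B : ℕ}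
    (hB : 16 * j ^ 2 * B ≤ Q ^ P) :
    ∃ k, 3 ≤ k ∧ k + 3 ≤ 8 * j ∧
      B < (E.filter fun x => x + k * ∑ i ∈ range P, Q ^ i ∈ E).card := by
  by_contra! hle
  set u := ∑ i ∈ range P, Q ^ i with hu
  have hu16 : 16 * j * u ≤ Q ^ P := by
    have h1 := Nat.geomSum_eq (show 2 ≤ Q by omega) P
    have h2 : (Q - 1) * u ≤ Q ^ P := by
      rw [hu, h1]
      exact (Nat.mul_div_le _ _).trans (Nat.sub_le _ _)
    exact (Nat.mul_le_mul_right u (by omega)).trans h2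
  have key := mul_card_le_card_biUnion_add (fun l => E.image (· + 3 * l * u)) E.card B
    (fun l => card_image_of_injective _ (add_left_injective _)) (2 * j) (by
      intro l l' hll hl'
      refine le_trans ?_ (hle (3 * (l' - l)) (by omega) (by omega))
      refine (card_le_card (t := (E.filter fun x => x + 3 * (l' - l) * u ∈ E).image
        (· + 3 * l' * u)) ?_).trans card_image_le
      intro n hn
      obtain ⟨h1, h2⟩ := mem_inter.1 hn
      obtain ⟨a, ha, hna⟩ := mem_image.1 h1
      obtain ⟨b, hb, hnb⟩ := mem_image.1 h2
      refine mem_image.2 ⟨b, mem_filter.2 ⟨hb, ?_⟩, hnb⟩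
      obtain ⟨r, rfl⟩ := Nat.exists_eq_add_of_lt hll
      have : b + 3 * (l + r + 1 - l) * u = a := by
        rw [show l + r + 1 - l = r + 1 by omega]
        nlinarith
      rwa [this])
  have hun : ((range (2 * j)).biUnion fun l => E.image (· + 3 * l * u)).card
      ≤ Q ^ P + 6 * j * u := by
    rw [← card_range (Q ^ P + 6 * j * u)]
    refine card_le_card fun n hn => ?_
    obtain ⟨l, hl, hn⟩ := mem_biUnion.1 hn
    obtain ⟨a, ha, rfl⟩ := mem_image.1 hn
    have h1 := mem_range.1 (hE ha)
    have h2 : 3 * l * u ≤ 6 * j * u := by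
      have := mem_range.1 hl
      exact Nat.mul_le_mul_right u (by omega)
    simp only [mem_range]
    omega
  nlinarith

/-- Combinatorial lemma: if `Q` is even and large enough compared to `j`, and
`P > Q log(2j²)`, then any `E ⊆ {0, ..., Q^P - 1}` with `|E| > Q^P / j` contains a positive
difference `y = a - b` whose base-`Q` digits `y_i = ⌊y/Qⁱ⌋ mod Q` satisfy: for exactly one
index `s`, `Q/2 ≤ y_s < Q/2 + 8j`, and `1 ≤ y_i < 8j` for all other indices `i < P`. -/
theorem digit_difference_lemma (j Q : ℕ) (hj : 0 < j) (hQeven : Even Q)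
    (hQlarge : Q / 2 + 8 * j < Q)
    (P : ℕ) (hP : (P : ℝ) > Q * Real.log (2 * j ^ 2))
    (E : Finset ℕ) (hE : E ⊆ Finset.range (Q ^ P)) (hcard : (E.card : ℝ) > (Q : ℝ) ^ P / j) :
    ∃ a ∈ E, ∃ b ∈ E, b < a ∧
      ∃ s : ℕ, s < P ∧
        (Q / 2 ≤ (a - b) / Q ^ s % Q ∧ (a - b) / Q ^ s % Q < Q / 2 + 8 * j) ∧
        ∀ i : ℕ, i < P → i ≠ s →
          1 ≤ (a - b) / Q ^ i % Q ∧ (a - b) / Q ^ i % Q < 8 * j := by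
  have hQ : 16 * j < Q := by
    obtain ⟨r, rfl⟩ := hQeven
    omega
  have hcard' : Q ^ P < j * E.card := by
    rw [gt_iff_lt, div_lt_iff₀ (by positivity)] at hcard
    rw [mul_comm]
    exact_mod_cast hcard
  have hj2 : 2 ≤ j := by
    by_contra hlt
    have h1 := card_le_card hE
    rw [card_range] at h1
    rw [show j = 1 by omega] at hcard'
    omega
  have hB : 16 * j ^ 2 * (Q - 2) ^ P ≤ Q ^ P := by
    have h1 : 4 * j ^ 4 * (Q - 2) ^ P ≤ Q ^ P := by
      exact_mod_cast four_mul_pow_four_mul_sub_two_pow_le hj (by omega) hP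
    refine le_trans (Nat.mul_le_mul_right _ ?_) h1
    have h2 : 2 ^ 2 ≤ j ^ 2 := Nat.pow_le_pow_left hj2 2
    nlinarith
  obtain ⟨k, hk3, hk8, hk⟩ := exists_many_repunit_shifts hj2 hQ hE hcard' hB
  obtain ⟨b, hb, y, hy, s, e, hs, hes, he, hyb⟩ :=
    exists_digit_jump (h := Q / 2) (by omega) (by omega) P _ ((filter_subset _ _).trans hE) hk
  have hd : ∀ i, ((e i + k).toNat : ℤ) = e i + k := fun i => by
    refine Int.toNat_of_nonneg ?_
    by_cases hi : i = s
    · subst hi; omega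
    · have := he i hi; omega
  have hdlt : ∀ i, (e i + k).toNat < Q := fun i => by
    by_cases hi : i = s
    · subst hi; omega
    · have := he i hi; omega
  have hab : y + k * ∑ i ∈ range P, Q ^ i = b + ∑ i ∈ range P, (e i + k).toNat * Q ^ i := by
    zify
    simp_rw [hd, add_mul, sum_add_distrib, ← mul_sum]
    rw [hyb]
    ring
  have hpos : 0 < ∑ i ∈ range P, (e i + k).toNat * Q ^ i :=
    lt_of_lt_of_le (Nat.mul_pos (by omega) (Nat.pow_pos (by omega)))
      (single_le_sum (f := fun i => (e i + k).toNat * Q ^ i) (fun _ _ => Nat.zero_le _)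
        (mem_range.2 hs))
  refine ⟨_, (mem_filter.1 hy).2, b, (mem_filter.1 hb).1, by omega, s, hs, ?_, fun i hi his => ?_⟩
  · rw [hab, Nat.add_sub_cancel_left, sum_mul_pow_div_mod P _ hdlt s hs]
    omega
  · rw [hab, Nat.add_sub_cancel_left, sum_mul_pow_div_mod P _ hdlt i hi]
    have := he i his
    omega
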